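/- Define d_n = (48^{2n}/(n!)²)·c_{6,2n+1} for integers n ≥ 0. Then for every n ≥ 0, (2n+5)(n+3)²(n+2)²·d_{n+3} − 32(n+2)³(196n²+784n+843)·d_{n+2} + 64·48²·(2n+3)(14n⁴+84n³+196n²+210n+87)·d_{n+1} − 128·48⁴·(n+1)⁵·d_n = 0. -/

import Mathlib

open MeasureTheory

/-- The modified Bessel function `K₀`, via `K₀(x) = ∫₀^∞ exp(−x cosh t) dt`. -/
noncomputable def besselK0 (x : ℝ) : ℝ :=
  ∫ t in Set.Ioi (0 : ℝ), Real.exp (-x * Real.cosh t)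

/-- The Bessel moment `c_{m,k} = ∫₀^∞ x^k K₀(x)^m dx`. -/
noncomputable def besselMoment (m k : ℕ) : ℝ :=
  ∫ x in Set.Ioi (0 : ℝ), x ^ k * besselK0 x ^ m

/-- The functions `∫₀^∞ cosh(t)^j exp(−x cosh t) dt`, the derivatives of `K₀` up to sign. -/
noncomputable def besselCoshIntegral (j : ℕ) (x : ℝ) : ℝ :=
  ∫ t in Set.Ioi (0 : ℝ), Real.cosh t ^ j * Real.exp (-x * Real.cosh t)

/-- The mixed moments `∫₀^∞ x^p K₀(x)^a (x K₁(x))^b dx`. -/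
noncomputable def besselMixedMoment (p a b : ℕ) : ℝ :=
  ∫ x in Set.Ioi (0 : ℝ),
    x ^ p * besselCoshIntegral 0 x ^ a * (x * besselCoshIntegral 1 x) ^ b

lemma besselK0_eq_besselCoshIntegral (x : ℝ) : besselK0 x = besselCoshIntegral 0 x := by
  simp [besselK0, besselCoshIntegral]

lemma exp_div_two_le_cosh (t : ℝ) : Real.exp t / 2 ≤ Real.cosh t := by
  rw [Real.cosh_eq]
  have := Real.exp_pos (-t)
  linarith

lemma integrableOn_cosh_pow_mul_exp (j : ℕ) {x : ℝ} (hx : 0 < x) :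
    IntegrableOn (fun t => Real.cosh t ^ j * Real.exp (-x * Real.cosh t)) (Set.Ioi 0) := by
  have hb : IntegrableOn
      (fun t => ((j + 1).factorial : ℝ) / x ^ (j + 1) * (2 * Real.exp (-t))) (Set.Ioi 0) :=
    ((integrableOn_exp_neg_Ioi 0).const_mul 2).const_mul _
  refine hb.mono' (by fun_prop) (Filter.Eventually.of_forall fun t => ?_)
  have hc := Real.cosh_pos t
  have h1 := Real.pow_div_factorial_le_exp (x * Real.cosh t) (by positivity) (j + 1)
  have h2 := exp_div_two_le_cosh t
  rw [Real.norm_of_nonneg (by positivity), neg_mul, Real.exp_neg, Real.exp_neg]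
  have h3 : (Real.cosh t)⁻¹ ≤ 2 * (Real.exp t)⁻¹ := by
    rw [show 2 * (Real.exp t)⁻¹ = (Real.exp t / 2)⁻¹ by field_simp]
    exact inv_anti₀ (by positivity) h2
  have h4 : (Real.exp (x * Real.cosh t))⁻¹
      ≤ ((x * Real.cosh t) ^ (j + 1) / ((j + 1).factorial : ℝ))⁻¹ :=
    inv_anti₀ (by positivity) h1
  calc Real.cosh t ^ j * (Real.exp (x * Real.cosh t))⁻¹
      ≤ Real.cosh t ^ j * ((x * Real.cosh t) ^ (j + 1) / ((j + 1).factorial : ℝ))⁻¹ := by gcongr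
    _ = ((j + 1).factorial : ℝ) / x ^ (j + 1) * (Real.cosh t)⁻¹ := by
        rw [mul_pow, pow_succ (Real.cosh t)]; field_simp
    _ ≤ _ := by gcongr

lemma hasDerivAt_besselCoshIntegral (j : ℕ) {x : ℝ} (hx : 0 < x) :
    HasDerivAt (besselCoshIntegral j) (-besselCoshIntegral (j + 1) x) x := by
  have key := hasDerivAt_integral_of_dominated_loc_of_deriv_le
    (μ := volume.restrict (Set.Ioi (0 : ℝ)))
    (F := fun x t => Real.cosh t ^ j * Real.exp (-x * Real.cosh t))
    (F' := fun x t => -(Real.cosh t ^ (j + 1) * Real.exp (-x * Real.cosh t)))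
    (bound := fun t => Real.cosh t ^ (j + 1) * Real.exp (-(x / 2) * Real.cosh t))
    (s := Set.Ioi (x / 2)) (x₀ := x) (Ioi_mem_nhds (by linarith))
    (Filter.Eventually.of_forall fun y => by fun_prop)
    (integrableOn_cosh_pow_mul_exp j hx) (by fun_prop)
    (Filter.Eventually.of_forall fun t y hy => ?_)
    (integrableOn_cosh_pow_mul_exp (j + 1) (half_pos hx))
    (Filter.Eventually.of_forall fun t y _ => ?_)
  · have h := key.2
    rw [integral_neg] at h
    exact h
  · have hc := Real.cosh_pos t
    rw [norm_neg, Real.norm_of_nonneg (by positivity)]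
    have : x / 2 ≤ y := le_of_lt hy
    gcongr
  · have h := (((hasDerivAt_id y).neg.mul_const (Real.cosh t)).exp).const_mul (Real.cosh t ^ j)
    refine h.congr_deriv ?_
    simp only [Pi.neg_apply, id]
    ring

lemma mul_besselCoshIntegral_two {x : ℝ} (hx : 0 < x) :
    x * besselCoshIntegral 2 x = x * besselCoshIntegral 0 x + besselCoshIntegral 1 x := by
  have i0 := integrableOn_cosh_pow_mul_exp 0 hx
  have i1 := integrableOn_cosh_pow_mul_exp 1 hx
  have i2 := integrableOn_cosh_pow_mul_exp 2 hx
  have hlim : Filter.Tendsto (fun t => Real.sinh t * Real.exp (-x * Real.cosh t))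
      Filter.atTop (nhds 0) := by
    have hb : Filter.Tendsto (fun t => 2 / x ^ 2 * (2 * Real.exp (-t))) Filter.atTop (nhds 0) := by
      simpa using (Real.tendsto_exp_neg_atTop_nhds_zero.const_mul 2).const_mul (2 / x ^ 2)
    refine squeeze_zero' ?_ ?_ hb
    · filter_upwards [Filter.eventually_ge_atTop 0] with t ht
      have := Real.sinh_nonneg_iff.2 ht
      positivity
    · refine Filter.Eventually.of_forall fun t => ?_
      have hc := Real.cosh_pos t
      have h1 := Real.pow_div_factorial_le_exp (x * Real.cosh t) (by positivity) 2
      have h3 : (Real.cosh t)⁻¹ ≤ 2 * (Real.exp t)⁻¹ := by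
        rw [show 2 * (Real.exp t)⁻¹ = (Real.exp t / 2)⁻¹ by field_simp]
        exact inv_anti₀ (by positivity) (exp_div_two_le_cosh t)
      have h4 : (Real.exp (x * Real.cosh t))⁻¹ ≤ ((x * Real.cosh t) ^ 2 / 2)⁻¹ :=
        inv_anti₀ (by positivity) (by simpa using h1)
      rw [neg_mul, Real.exp_neg, Real.exp_neg]
      calc Real.sinh t * (Real.exp (x * Real.cosh t))⁻¹
          ≤ Real.cosh t * ((x * Real.cosh t) ^ 2 / 2)⁻¹ := by
            have := (Real.sinh_lt_cosh t).le
            gcongr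
        _ = 2 / x ^ 2 * (Real.cosh t)⁻¹ := by field_simp
        _ ≤ _ := by gcongr
  have h := integral_Ioi_of_hasDerivAt_of_tendsto'
    (f := fun t => Real.sinh t * Real.exp (-x * Real.cosh t))
    (f' := fun t => Real.cosh t ^ 1 * Real.exp (-x * Real.cosh t)
      - x * (Real.cosh t ^ 2 * Real.exp (-x * Real.cosh t))
      + x * (Real.cosh t ^ 0 * Real.exp (-x * Real.cosh t))) (a := 0) (m := 0)
    (fun t _ => ?_) ((i1.sub (i2.const_mul x)).add (i0.const_mul x)) hlim
  · rw [integral_add (by exact i1.sub (i2.const_mul x)) (i0.const_mul x),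
      integral_sub i1 (i2.const_mul x), integral_const_mul, integral_const_mul] at h
    simp only [Real.sinh_zero, zero_mul, sub_zero] at h
    unfold besselCoshIntegral
    linarith
  · have h := (Real.hasDerivAt_sinh t).mul (((Real.hasDerivAt_cosh t).const_mul (-x)).exp)
    refine h.congr_deriv ?_
    rw [Real.cosh_sq]
    ring

lemma hasDerivAt_mul_besselCoshIntegral_one {x : ℝ} (hx : 0 < x) :
    HasDerivAt (fun x => x * besselCoshIntegral 1 x) (-(x * besselCoshIntegral 0 x)) x := by
  refine ((hasDerivAt_id x).mul (hasDerivAt_besselCoshIntegral 1 hx)).congr_deriv ?_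
  have := mul_besselCoshIntegral_two hx
  simp only [id]
  norm_num
  linarith

lemma besselCoshIntegral_nonneg (j : ℕ) (x : ℝ) : 0 ≤ besselCoshIntegral j x :=
  integral_nonneg fun t => by have := Real.cosh_pos t; positivity

lemma besselCoshIntegral_zero_le {x : ℝ} (hx : 0 < x) :
    besselCoshIntegral 0 x ≤ 4 * (x / 4) ^ (-(1 / 4) : ℝ) * Real.exp (-(x / 2)) := by
  have hi : IntegrableOn (fun t => (x / 4) ^ (-(1 / 4) : ℝ) * Real.exp (-(x / 2))
      * Real.exp ((-(1 / 4) : ℝ) * t)) (Set.Ioi 0) :=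
    (integrableOn_exp_mul_Ioi (by norm_num) 0).const_mul _
  have h : besselCoshIntegral 0 x ≤ ∫ t in Set.Ioi (0 : ℝ),
      (x / 4) ^ (-(1 / 4) : ℝ) * Real.exp (-(x / 2)) * Real.exp ((-(1 / 4) : ℝ) * t) := by
    refine setIntegral_mono (integrableOn_cosh_pow_mul_exp 0 hx) hi fun t => ?_
    have h1 := Real.one_le_cosh t
    have h2 := exp_div_two_le_cosh t
    have h3 : x / 4 * Real.exp t ≤ Real.exp (2 * (x * Real.cosh t)) := by
      have := Real.add_one_le_exp (2 * (x * Real.cosh t))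
      nlinarith
    have h4 : (Real.exp (2 * (x * Real.cosh t))) ^ (-(1 / 4) : ℝ)
        ≤ (x / 4 * Real.exp t) ^ (-(1 / 4) : ℝ) :=
      Real.rpow_le_rpow_of_nonpos (by positivity) h3 (by norm_num)
    rw [Real.mul_rpow (by positivity) (by positivity), ← Real.exp_mul, ← Real.exp_mul] at h4
    have h5 : Real.exp (-x * Real.cosh t) ≤
        Real.exp (-(x / 2)) * Real.exp (2 * (x * Real.cosh t) * (-(1 / 4) : ℝ)) := by
      rw [← Real.exp_add, Real.exp_le_exp]
      nlinarith
    calc Real.cosh t ^ 0 * Real.exp (-x * Real.cosh t)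
        ≤ Real.exp (-(x / 2)) * Real.exp (2 * (x * Real.cosh t) * (-(1 / 4) : ℝ)) := by
          simpa using h5
      _ ≤ Real.exp (-(x / 2)) * ((x / 4) ^ (-(1 / 4) : ℝ) * Real.exp (t * (-(1 / 4) : ℝ))) := by
          gcongr
      _ = _ := by rw [mul_comm t]; ring
  refine h.trans_eq ?_
  rw [integral_const_mul, integral_exp_mul_Ioi (by norm_num)]
  norm_num
  ring

lemma besselCoshIntegral_zero_half_le {x : ℝ} (hx : 0 < x) :
    2 * besselCoshIntegral 0 (x / 2)
      ≤ 8 * (1 / 8) ^ (-(1 / 4) : ℝ) * (x ^ (-(1 / 4) : ℝ) * Real.exp (-(x / 4))) := by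
  have h := besselCoshIntegral_zero_le (half_pos hx)
  rw [show x / 2 / 4 = 1 / 8 * x by ring, Real.mul_rpow (by norm_num) hx.le,
    show x / 2 / 2 = x / 4 by ring] at h
  linarith

lemma besselCoshIntegral_zero_le_half {x : ℝ} (hx : 0 < x) :
    besselCoshIntegral 0 x ≤ 2 * besselCoshIntegral 0 (x / 2) := by
  have h : besselCoshIntegral 0 x ≤ besselCoshIntegral 0 (x / 2) := by
    refine setIntegral_mono (integrableOn_cosh_pow_mul_exp 0 hx)
      (integrableOn_cosh_pow_mul_exp 0 (half_pos hx)) fun t => ?_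
    have hc := Real.cosh_pos t
    have : x / 2 ≤ x := by linarith
    dsimp only
    gcongr
  linarith [besselCoshIntegral_nonneg 0 (x / 2)]

lemma mul_besselCoshIntegral_one_le_half {x : ℝ} (hx : 0 < x) :
    x * besselCoshIntegral 1 x ≤ 2 * besselCoshIntegral 0 (x / 2) := by
  unfold besselCoshIntegral
  rw [← integral_const_mul, ← integral_const_mul]
  refine setIntegral_mono ((integrableOn_cosh_pow_mul_exp 1 hx).const_mul x)
    ((integrableOn_cosh_pow_mul_exp 0 (half_pos hx)).const_mul 2) fun t => ?_
  have h1 := Real.add_one_le_exp (x / 2 * Real.cosh t)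
  have h2 : Real.exp (-(x / 2) * Real.cosh t)
      = Real.exp (x / 2 * Real.cosh t) * Real.exp (-x * Real.cosh t) := by
    rw [← Real.exp_add]; ring_nf
  have h3 := Real.exp_pos (-x * Real.cosh t)
  simp only [pow_one, pow_zero, one_mul]
  rw [h2]
  nlinarith

lemma besselProduct_le {p a b : ℕ} (hab : a + b = 6) {x : ℝ} (hx : 0 < x) :
    x ^ p * besselCoshIntegral 0 x ^ a * (x * besselCoshIntegral 1 x) ^ b
      ≤ (8 * (1 / 8) ^ (-(1 / 4) : ℝ)) ^ 6
        * (x ^ ((p : ℝ) - 3 / 2) * Real.exp (-(3 / 2) * x)) := by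
  have h0 := (besselCoshIntegral_zero_le_half hx).trans (besselCoshIntegral_zero_half_le hx)
  have h1 := (mul_besselCoshIntegral_one_le_half hx).trans (besselCoshIntegral_zero_half_le hx)
  have n0 := besselCoshIntegral_nonneg 0 x
  have n1 : 0 ≤ x * besselCoshIntegral 1 x := mul_nonneg hx.le (besselCoshIntegral_nonneg 1 x)
  generalize (8 : ℝ) * (1 / 8) ^ (-(1 / 4) : ℝ) = C at h0 h1 ⊢
  set B := C * (x ^ (-(1 / 4) : ℝ) * Real.exp (-(x / 4))) with hB
  have nB : 0 ≤ B := n0.trans h0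
  calc x ^ p * besselCoshIntegral 0 x ^ a * (x * besselCoshIntegral 1 x) ^ b
      ≤ x ^ p * B ^ a * B ^ b := by gcongr
    _ = x ^ p * B ^ 6 := by rw [mul_assoc, ← pow_add, hab]
    _ = _ := by
      rw [hB, mul_pow, mul_pow (x ^ _), ← Real.exp_nat_mul, ← Real.rpow_mul_natCast hx.le,
        sub_eq_add_neg, Real.rpow_add hx, Real.rpow_natCast]
      ring_nf

lemma hasDerivAt_besselProduct (p a b : ℕ) {x : ℝ} (hx : 0 < x) :
    HasDerivAt
      (fun x => x ^ (p + 1) * besselCoshIntegral 0 x ^ a * (x * besselCoshIntegral 1 x) ^ b)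
      ((p + 1) * (x ^ p * besselCoshIntegral 0 x ^ a * (x * besselCoshIntegral 1 x) ^ b)
        - a * (x ^ p * besselCoshIntegral 0 x ^ (a - 1)
          * (x * besselCoshIntegral 1 x) ^ (b + 1))
        - b * (x ^ (p + 2) * besselCoshIntegral 0 x ^ (a + 1)
          * (x * besselCoshIntegral 1 x) ^ (b - 1))) x := by
  refine (((hasDerivAt_pow (p + 1) x).mul ((hasDerivAt_besselCoshIntegral 0 hx).pow a)).mul
    ((hasDerivAt_mul_besselCoshIntegral_one hx).pow b)).congr_deriv ?_
  simp only [Pi.mul_apply, Pi.pow_apply, Nat.add_sub_cancel]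
  push_cast
  ring

lemma integrableOn_besselProduct {p a b : ℕ} (hp : 1 ≤ p) (hab : a + b = 6) :
    IntegrableOn (fun x => x ^ p * besselCoshIntegral 0 x ^ a
      * (x * besselCoshIntegral 1 x) ^ b) (Set.Ioi 0) := by
  have hp' : (1 : ℝ) ≤ p := by exact_mod_cast hp
  have hb := (integrableOn_rpow_mul_exp_neg_mul_rpow (p := 1) (s := (p : ℝ) - 3 / 2) (b := 3 / 2)
    (by linarith) one_pos (by norm_num)).const_mul ((8 * (1 / 8) ^ (-(1 / 4) : ℝ)) ^ 6)
  refine hb.mono' (ContinuousOn.aestronglyMeasurable (fun x hx => ?_) measurableSet_Ioi) ?_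
  · have c0 := (hasDerivAt_besselCoshIntegral 0 hx).continuousAt
    have c1 := (hasDerivAt_mul_besselCoshIntegral_one hx).continuousAt
    exact (((continuousAt_id.pow p).mul (c0.pow a)).mul (c1.pow b)).continuousWithinAt
  · filter_upwards [ae_restrict_mem measurableSet_Ioi] with x hx
    have hx' : 0 < x := hx
    have n0 := besselCoshIntegral_nonneg 0 x
    have n1 := besselCoshIntegral_nonneg 1 x
    rw [Real.norm_of_nonneg (by positivity)]
    simpa using besselProduct_le (p := p) hab hx'

lemma besselMixedMoment_recursion {p a b : ℕ} (hp : 1 ≤ p) (hab : a + b = 6) :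
    ((p : ℝ) + 1) * besselMixedMoment p a b
      = a * besselMixedMoment p (a - 1) (b + 1)
        + b * besselMixedMoment (p + 2) (a + 1) (b - 1) := by
  have i0 := (integrableOn_besselProduct hp hab).const_mul ((p : ℝ) + 1)
  have i1 : IntegrableOn (fun x => (a : ℝ) * (x ^ p * besselCoshIntegral 0 x ^ (a - 1)
      * (x * besselCoshIntegral 1 x) ^ (b + 1))) (Set.Ioi 0) := by
    rcases Nat.eq_zero_or_pos a with rfl | ha
    · simp
    · exact (integrableOn_besselProduct hp (by omega)).const_mul _
  have i2 : IntegrableOn (fun x => (b : ℝ) * (x ^ (p + 2) * besselCoshIntegral 0 x ^ (a + 1)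
      * (x * besselCoshIntegral 1 x) ^ (b - 1))) (Set.Ioi 0) := by
    rcases Nat.eq_zero_or_pos b with rfl | hb
    · simp
    · exact (integrableOn_besselProduct (by omega) (by omega)).const_mul _
  have hp' : (1 : ℝ) ≤ p := by exact_mod_cast hp
  have nonneg : ∀ x : ℝ, 0 < x →
      0 ≤ x ^ (p + 1) * besselCoshIntegral 0 x ^ a * (x * besselCoshIntegral 1 x) ^ b := by
    intro x hx
    have n0 := besselCoshIntegral_nonneg 0 x
    have n1 := besselCoshIntegral_nonneg 1 x
    positivity
  have hcont : ContinuousWithinAt (fun x : ℝ => x ^ (p + 1) * besselCoshIntegral 0 x ^ a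
      * (x * besselCoshIntegral 1 x) ^ b) (Set.Ici 0) 0 := by
    rw [← Set.Ioi_insert, continuousWithinAt_insert_self, ContinuousWithinAt]
    have hc : ContinuousAt (fun x : ℝ => (8 * (1 / 8) ^ (-(1 / 4) : ℝ)) ^ 6
        * (x ^ (((p + 1 : ℕ) : ℝ) - 3 / 2) * Real.exp (-(3 / 2) * x))) 0 := by
      refine continuousAt_const.mul (ContinuousAt.mul ?_ (by fun_prop))
      exact Real.continuousAt_rpow_const _ _ (Or.inr (by push_cast; linarith))
    have hlim := hc.tendsto.mono_left (nhdsWithin_le_nhds (s := Set.Ioi 0))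
    rw [Real.zero_rpow (by push_cast; linarith)] at hlim
    simp only [zero_mul, mul_zero] at hlim
    simp only [ne_eq, Nat.add_eq_zero_iff, one_ne_zero, and_false, not_false_eq_true, zero_pow,
      zero_mul]
    refine squeeze_zero' ?_ ?_ hlim
    · filter_upwards [self_mem_nhdsWithin] with x hx using nonneg x hx
    · filter_upwards [self_mem_nhdsWithin] with x hx using besselProduct_le hab hx
  have htop : Filter.Tendsto (fun x : ℝ => x ^ (p + 1) * besselCoshIntegral 0 x ^ a
      * (x * besselCoshIntegral 1 x) ^ b) Filter.atTop (nhds 0) := by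
    have hlim := (tendsto_rpow_mul_exp_neg_mul_atTop_nhds_zero (((p + 1 : ℕ) : ℝ) - 3 / 2) (3 / 2)
      (by norm_num)).const_mul ((8 * (1 / 8) ^ (-(1 / 4) : ℝ)) ^ 6)
    rw [mul_zero] at hlim
    refine squeeze_zero' ?_ ?_ hlim
    · filter_upwards [Filter.eventually_gt_atTop 0] with x hx using nonneg x hx
    · filter_upwards [Filter.eventually_gt_atTop 0] with x hx using besselProduct_le hab hx
  have h := integral_Ioi_of_hasDerivAt_of_tendsto hcont
    (fun x hx => hasDerivAt_besselProduct p a b hx) ((i0.sub i1).sub i2) htop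
  rw [integral_sub (by exact i0.sub i1) i2, integral_sub i0 i1, integral_const_mul, integral_const_mul,
    integral_const_mul] at h
  simp only [ne_eq, Nat.add_eq_zero_iff, one_ne_zero, and_false, not_false_eq_true, zero_pow,
    zero_mul, sub_zero] at h
  unfold besselMixedMoment
  linarith

lemma besselMoment_six_eq (p : ℕ) : besselMoment 6 p = besselMixedMoment p 6 0 := by
  simp [besselMoment, besselMixedMoment, besselK0_eq_besselCoshIntegral]

lemma besselMoment_six_recursion (n : ℕ) :
    2304 * (2 * (n : ℝ) + 5) * besselMoment 6 (2 * n + 7)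
      - 32 * ((n : ℝ) + 2) * (196 * (n : ℝ) ^ 2 + 784 * n + 843) * besselMoment 6 (2 * n + 5)
      + 64 * (2 * (n : ℝ) + 3)
          * (14 * (n : ℝ) ^ 4 + 84 * (n : ℝ) ^ 3 + 196 * (n : ℝ) ^ 2 + 210 * n + 87)
          * besselMoment 6 (2 * n + 3)
      - 128 * ((n : ℝ) + 1) ^ 7 * besselMoment 6 (2 * n + 1) = 0 := by
  simp only [besselMoment_six_eq]
  have r0 (m : ℕ) := besselMixedMoment_recursion (p := 2 * m + 1) (a := 6) (b := 0)
    (by omega) rfl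
  have r1 (m : ℕ) := besselMixedMoment_recursion (p := 2 * m + 1) (a := 5) (b := 1)
    (by omega) rfl
  have r2 (m : ℕ) := besselMixedMoment_recursion (p := 2 * m + 1) (a := 4) (b := 2)
    (by omega) rfl
  have r3 (m : ℕ) := besselMixedMoment_recursion (p := 2 * m + 1) (a := 3) (b := 3)
    (by omega) rfl
  have r4 (m : ℕ) := besselMixedMoment_recursion (p := 2 * m + 1) (a := 2) (b := 4)
    (by omega) rfl
  have r5 (m : ℕ) := besselMixedMoment_recursion (p := 2 * m + 1) (a := 1) (b := 5)
    (by omega) rfl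
  have r6 := besselMixedMoment_recursion (p := 2 * n + 1) (a := 0) (b := 6)
    (by omega) rfl
  norm_num [add_assoc] at r0 r1 r2 r3 r4 r5 r6
  have e1 (m : ℕ) : besselMixedMoment (2 * m + 1) 5 1
      = (2 * m + 2) * besselMixedMoment (2 * m + 1) 6 0 / 6 := by linarith [r0 m]
  have e2 (m : ℕ) : besselMixedMoment (2 * m + 1) 4 2
      = ((2 * m + 2) * besselMixedMoment (2 * m + 1) 5 1
        - besselMixedMoment (2 * m + 3) 6 0) / 5 := by linarith [r1 m]
  have e3 (m : ℕ) : besselMixedMoment (2 * m + 1) 3 3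
      = ((2 * m + 2) * besselMixedMoment (2 * m + 1) 4 2
        - 2 * besselMixedMoment (2 * m + 3) 5 1) / 4 := by linarith [r2 m]
  have e4 (m : ℕ) : besselMixedMoment (2 * m + 1) 2 4
      = ((2 * m + 2) * besselMixedMoment (2 * m + 1) 3 3
        - 3 * besselMixedMoment (2 * m + 3) 4 2) / 3 := by linarith [r3 m]
  have e5 (m : ℕ) : besselMixedMoment (2 * m + 1) 1 5
      = ((2 * m + 2) * besselMixedMoment (2 * m + 1) 2 4
        - 4 * besselMixedMoment (2 * m + 3) 3 3) / 2 := by linarith [r4 m]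
  have e6 : besselMixedMoment (2 * n + 1) 0 6
      = (2 * n + 2) * besselMixedMoment (2 * n + 1) 1 5
        - 5 * besselMixedMoment (2 * n + 3) 2 4 := by linarith [r5 n]
  have s1 : 2 * n + 3 = 2 * (n + 1) + 1 := by ring
  have s2 : 2 * (n + 1) + 3 = 2 * (n + 2) + 1 := by ring
  have s3 : 2 * (n + 2) + 3 = 2 * (n + 3) + 1 := by ring
  have s4 : 2 * n + 5 = 2 * (n + 2) + 1 := by ring
  have s5 : 2 * n + 7 = 2 * (n + 3) + 1 := by ring
  rw [e6] at r6
  simp only [s1, s2, s3, e5, e4, e3, e2, e1] at r6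
  rw [s1, s4, s5]
  push_cast at r6
  linear_combination (-720) * r6

/-- With `d_n = (48^{2n}/(n!)²) c_{6,2n+1}`, for every `n ≥ 0`,
`(2n+5)(n+3)²(n+2)² d_{n+3} − 32(n+2)³(196n²+784n+843) d_{n+2}
  + 64·48²(2n+3)(14n⁴+84n³+196n²+210n+87) d_{n+1} − 128·48⁴(n+1)⁵ d_n = 0`. -/
theorem bessel_moment_six_d_recursion
    (d : ℕ → ℝ)
    (hd : ∀ n, d n = 48 ^ (2 * n) / (n.factorial : ℝ) ^ 2 * besselMoment 6 (2 * n + 1))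
    (n : ℕ) :
    (2 * (n : ℝ) + 5) * ((n : ℝ) + 3) ^ 2 * ((n : ℝ) + 2) ^ 2 * d (n + 3)
      - 32 * ((n : ℝ) + 2) ^ 3 * (196 * (n : ℝ) ^ 2 + 784 * n + 843) * d (n + 2)
      + 64 * 48 ^ 2 * (2 * (n : ℝ) + 3)
          * (14 * (n : ℝ) ^ 4 + 84 * (n : ℝ) ^ 3 + 196 * (n : ℝ) ^ 2 + 210 * n + 87)
          * d (n + 1)
      - 128 * 48 ^ 4 * ((n : ℝ) + 1) ^ 5 * d n = 0 := by
  have h := besselMoment_six_recursion n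
  rw [hd, hd, hd, hd]
  simp only [Nat.factorial_succ, show 2 * (n + 3) + 1 = 2 * n + 7 by ring,
    show 2 * (n + 2) + 1 = 2 * n + 5 by ring, show 2 * (n + 1) + 1 = 2 * n + 3 by ring]
  have hn : (n.factorial : ℝ) ≠ 0 := by exact_mod_cast n.factorial_ne_zero
  have key := congrArg (fun y => 48 ^ (2 * n) * 48 ^ 4 / (((n : ℝ) + 1) * n.factorial) ^ 2 * y) h
  simp only [mul_zero] at key
  refine Eq.trans ?_ key
  have h1 : (n : ℝ) + 1 ≠ 0 := by positivity
  have h2 : (n : ℝ) + 2 ≠ 0 := by positivity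
  have h3 : (n : ℝ) + 3 ≠ 0 := by positivity
  push_cast
  rw [show (n : ℝ) + 1 + 1 = n + 2 by ring, show (n : ℝ) + 2 + 1 = n + 3 by ring]
  field_simp
  ring
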